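/- arXiv:2401.07733 — 5 statements merged into one kernel-verified Lean document; each statement's English description precedes it below -/
import Mathlib

section
/- Let 𝒳 be a measurable space, let n ≥ 1 and α ∈ (0,1) with α(n+1) ≥ 1, and let (X_1,Y_1),…,(X_{n+1},Y_{n+1}) be exchangeable random variables with values in 𝒳 × ℝ. Let μ be a symmetric regression algorithm and s a symmetric dispersion estimator, and let ĝ_{-i}, σ̂_{-i} and R_i (i = 1,…,n) be the associated leave-one-out predictors, leave-one-out dispersions and weighted leave-one-out non-conformity scores. Define the J+GP prediction interval Ĉ(X_{n+1}) = [ q̂⁻_{n,α}{ ĝ_{-i}(X_{n+1}) − R_i · σ̂_{-i}(X_{n+1}) } , q̂⁺_{n,α}{ ĝ_{-i}(X_{n+1}) + R_i · σ̂_{-i}(X_{n+1}) } ]. Then ℙ( Y_{n+1} ∈ Ĉ(X_{n+1}) ) ≥ 1 − 2α. -/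
open MeasureTheory

/-- The `k`-th smallest value (1-indexed) among `v 0, …, v (n-1)`. -/
noncomputable def orderStat {n : ℕ} (v : Fin n → ℝ) (k : ℕ) : ℝ :=
  if h : k - 1 < n then v (Tuple.sort v ⟨k - 1, h⟩) else 0

/-- The `(1-α)`-empirical quantile: the `⌈(1-α)(n+1)⌉`-th smallest value of `v`. -/
noncomputable def qPlus {n : ℕ} (α : ℝ) (v : Fin n → ℝ) : ℝ :=
  orderStat v ⌈(1 - α) * (n + 1)⌉₊

/-- The `α`-empirical quantile: the `⌊α(n+1)⌋`-th smallest value of `v`. -/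
noncomputable def qMinus {n : ℕ} (α : ℝ) (v : Fin n → ℝ) : ℝ :=
  orderStat v ⌊α * (n + 1)⌋₊

/-- A finite family of random variables is exchangeable if its joint law is invariant
under permutations of the indices. -/
def Exchangeable {Ω E : Type*} [MeasurableSpace Ω] [MeasurableSpace E]
    (P : Measure Ω) {m : ℕ} (Z : Fin m → Ω → E) : Prop :=
  ∀ π : Equiv.Perm (Fin m),
    Measure.map (fun ω i => Z (π i) ω) P = Measure.map (fun ω i => Z i ω) P

/-- A regression/dispersion algorithm (assigning to each finite sample of points of
`𝒳 × ℝ` a function `𝒳 → ℝ`) is symmetric if it depends on the training sample only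
through its multiset of values. -/
def IsSymmetricAlg {𝒳 : Type*} (μ : (m : ℕ) → (Fin m → 𝒳 × ℝ) → 𝒳 → ℝ) : Prop :=
  ∀ (m : ℕ) (π : Equiv.Perm (Fin m)) (d : Fin m → 𝒳 × ℝ), μ m (d ∘ ⇑π) = μ m d

open Finset in
/-- If the `r`-th smallest value lies below `y`, then so do at least `r` of the values. -/
lemma le_card_lt_of_orderStat_lt {n r : ℕ} {v : Fin n → ℝ} {y : ℝ} (hr : r ≤ n)
    (h : orderStat v r < y) : r ≤ #{i | v i < y} := by
  rcases Nat.eq_zero_or_pos r with rfl | hr0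
  · exact Nat.zero_le _
  have hlt : r - 1 < n := by omega
  rw [orderStat, dif_pos hlt] at h
  calc r = #((Iic (⟨r - 1, hlt⟩ : Fin n)).map (Tuple.sort v).toEmbedding) := by
        rw [card_map, Fin.card_Iic]
        simp only
        omega
    _ ≤ _ := by
        refine card_le_card fun i hi => ?_
        obtain ⟨p, hp, rfl⟩ := mem_map.1 hi
        exact mem_filter.2 ⟨mem_univ _,
          (Tuple.monotone_sort v (mem_Iic.1 hp)).trans_lt h⟩

open Finset in
/-- If the `r`-th smallest value lies above `y`, then so do at least `n + 1 - r` of the values. -/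
lemma le_card_gt_of_lt_orderStat {n r : ℕ} {v : Fin n → ℝ} {y : ℝ} (hr0 : 1 ≤ r) (hr : r ≤ n)
    (h : y < orderStat v r) : n + 1 ≤ #{i | y < v i} + r := by
  have hlt : r - 1 < n := by omega
  rw [orderStat, dif_pos hlt] at h
  have hcard : n + 1 - r ≤ #{i | y < v i} := by
    calc n + 1 - r = #((Ici (⟨r - 1, hlt⟩ : Fin n)).map (Tuple.sort v).toEmbedding) := by
          rw [card_map, Fin.card_Ici]
          simp only
          omega
      _ ≤ _ := by
          refine card_le_card fun i hi => ?_
          obtain ⟨p, hp, rfl⟩ := mem_map.1 hi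
          exact mem_filter.2 ⟨mem_univ _,
            h.trans_le (Tuple.monotone_sort v (mem_Ici.1 hp))⟩
  omega

open Finset in
/-- In a tournament on `ι`, at most `2 * (|ι| - c)` players win at least `c` games. -/
lemma card_le_of_asymm {ι : Type*} [Fintype ι] (A : ι → ι → Prop)
    [∀ i j, Decidable (A i j)] (hA : ∀ i j, A i j → ¬ A j i) {c : ℝ} (hc : c ≤ Fintype.card ι) :
    (#{j | c ≤ (#{i | A j i} : ℝ)} : ℝ) ≤ 2 * (Fintype.card ι - c) := by
  classical
  set T : Finset ι := {j | c ≤ (#{i | A j i} : ℝ)}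
  let a : ι → ι → ℝ := fun j i => if A j i then 1 else 0
  have hwins : (#T : ℝ) * c ≤ ∑ j ∈ T, ∑ i, a j i := by
    rw [← nsmul_eq_mul]
    refine card_nsmul_le_sum _ _ _ fun j hj => ?_
    simpa [a] using (mem_filter.1 hj).2
  have hsplit : ∑ j ∈ T, ∑ i, a j i = ∑ j ∈ T, ∑ i ∈ T, a j i + ∑ j ∈ T, ∑ i ∈ Tᶜ, a j i := by
    rw [← sum_add_distrib]
    exact sum_congr rfl fun j _ => (sum_add_sum_compl T _).symm
  have hinner : 2 * ∑ j ∈ T, ∑ i ∈ T, a j i ≤ (#T : ℝ) * #T := by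
    calc 2 * ∑ j ∈ T, ∑ i ∈ T, a j i = ∑ j ∈ T, ∑ i ∈ T, (a j i + a i j) := by
          simp_rw [sum_add_distrib]
          rw [sum_comm (f := fun j i => a i j), two_mul]
      _ ≤ ∑ j ∈ T, ∑ i ∈ T, (1 : ℝ) := by
          refine sum_le_sum fun j _ => sum_le_sum fun i _ => ?_
          have := hA j i
          by_cases h1 : A j i <;> by_cases h2 : A i j <;> simp_all [a]
      _ = _ := by simp
  have houter : ∑ j ∈ T, ∑ i ∈ Tᶜ, a j i ≤ (#T : ℝ) * (Fintype.card ι - #T) := by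
    calc ∑ j ∈ T, ∑ i ∈ Tᶜ, a j i ≤ ∑ j ∈ T, ∑ i ∈ Tᶜ, (1 : ℝ) := by
          refine sum_le_sum fun j _ => sum_le_sum fun i _ => ?_
          by_cases h : A j i <;> simp [a, h]
      _ = _ := by simp [card_compl, Nat.cast_sub (card_le_univ T), mul_sub]
  rcases (Nat.cast_nonneg (α := ℝ) #T).eq_or_lt with h0 | h0
  · rw [← h0]; linarith
  · have : (#T : ℝ) * #T ≤ #T * (2 * (Fintype.card ι - c)) := by nlinarith
    exact le_of_mul_le_mul_left this h0

/-- A symmetric algorithm returns the same predictor on two enumerations of the same subsample. -/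
lemma IsSymmetricAlg.apply_comp_eq {𝒳 ι : Type*}
    {μ : (m : ℕ) → (Fin m → 𝒳 × ℝ) → 𝒳 → ℝ} (hμ : IsSymmetricAlg μ) {m : ℕ}
    {e e' : Fin m → ι} (he : Function.Injective e) (he' : Function.Injective e')
    (hr : Set.range e = Set.range e') (z : ι → 𝒳 × ℝ) : μ m (z ∘ e) = μ m (z ∘ e') := by
  let π : Equiv.Perm (Fin m) :=
    (Equiv.ofInjective e he).trans ((Equiv.setCongr hr).trans (Equiv.ofInjective e' he').symm)
  have hπ : e' ∘ π = e := by
    funext l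
    simp [π, Equiv.apply_ofInjective_symm]
  rw [← hπ, ← Function.comp_assoc, hμ]

/-- An enumeration of the indices different from `i` and `j` (junk when `i = j`). -/
def leaveTwoOut {k : ℕ} (i j : Fin (k + 2)) : Fin k → Fin (k + 2) :=
  if h : (({i, j} : Finset (Fin (k + 2)))ᶜ).card = k then Finset.orderEmbOfFin _ h else fun _ => i

lemma card_compl_pair {k : ℕ} {i j : Fin (k + 2)} (h : i ≠ j) :
    (({i, j} : Finset (Fin (k + 2)))ᶜ).card = k := by
  rw [Finset.card_compl, Finset.card_pair h, Fintype.card_fin]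
  omega

lemma leaveTwoOut_injective {k : ℕ} {i j : Fin (k + 2)} (h : i ≠ j) :
    Function.Injective (leaveTwoOut i j) := by
  rw [leaveTwoOut, dif_pos (card_compl_pair h)]
  exact (Finset.orderEmbOfFin _ _).injective

lemma range_leaveTwoOut {k : ℕ} {i j : Fin (k + 2)} (h : i ≠ j) :
    Set.range (leaveTwoOut i j) = {i, j}ᶜ := by
  rw [leaveTwoOut, dif_pos (card_compl_pair h), Finset.range_orderEmbOfFin,
    Finset.coe_compl, Finset.coe_pair]

/-- The weighted residual at the point `i` of the predictor trained without `i` and `j`. -/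
noncomputable def leaveTwoOutScore {𝒳 : Type*} (μ s : (m : ℕ) → (Fin m → 𝒳 × ℝ) → 𝒳 → ℝ) {k : ℕ}
    (z : Fin (k + 2) → 𝒳 × ℝ) (i j : Fin (k + 2)) : ℝ :=
  |(z i).2 - μ k (z ∘ leaveTwoOut i j) (z i).1| / s k (z ∘ leaveTwoOut i j) (z i).1

lemma leaveTwoOutScore_eq {𝒳 : Type*} {μ s : (m : ℕ) → (Fin m → 𝒳 × ℝ) → 𝒳 → ℝ}
    (hμ : IsSymmetricAlg μ) (hs : IsSymmetricAlg s) {k : ℕ} (z : Fin (k + 2) → 𝒳 × ℝ)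
    {i j : Fin (k + 2)} (hij : i ≠ j) {e : Fin k → Fin (k + 2)} (he : Function.Injective e)
    (hr : Set.range e = {i, j}ᶜ) :
    leaveTwoOutScore μ s z i j = |(z i).2 - μ k (z ∘ e) (z i).1| / s k (z ∘ e) (z i).1 := by
  have hre : Set.range (leaveTwoOut i j) = Set.range e := by rw [hr, range_leaveTwoOut hij]
  rw [leaveTwoOutScore, hμ.apply_comp_eq (leaveTwoOut_injective hij) he hre,
    hs.apply_comp_eq (leaveTwoOut_injective hij) he hre]

lemma leaveTwoOutScore_comp_perm {𝒳 : Type*} {μ s : (m : ℕ) → (Fin m → 𝒳 × ℝ) → 𝒳 → ℝ}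
    (hμ : IsSymmetricAlg μ) (hs : IsSymmetricAlg s) {k : ℕ} (z : Fin (k + 2) → 𝒳 × ℝ)
    (π : Equiv.Perm (Fin (k + 2))) {i j : Fin (k + 2)} (hij : i ≠ j) :
    leaveTwoOutScore μ s (z ∘ π) i j = leaveTwoOutScore μ s z (π i) (π j) := by
  rw [leaveTwoOutScore_eq hμ hs z (π.injective.ne hij)
    (π.injective.comp (leaveTwoOut_injective hij))]
  · rfl
  · rw [Set.range_comp, range_leaveTwoOut hij, Set.image_compl_eq π.bijective, Set.image_pair]

lemma measurable_leaveTwoOutScore {𝒳 : Type*} [MeasurableSpace 𝒳]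
    {μ s : (m : ℕ) → (Fin m → 𝒳 × ℝ) → 𝒳 → ℝ}
    (hμ : ∀ m, Measurable fun p : (Fin m → 𝒳 × ℝ) × 𝒳 => μ m p.1 p.2)
    (hs : ∀ m, Measurable fun p : (Fin m → 𝒳 × ℝ) × 𝒳 => s m p.1 p.2)
    {k : ℕ} (i j : Fin (k + 2)) :
    Measurable fun z : Fin (k + 2) → 𝒳 × ℝ => leaveTwoOutScore μ s z i j := by
  have hp : Measurable fun z : Fin (k + 2) → 𝒳 × ℝ => (z ∘ leaveTwoOut i j, (z i).1) := by
    refine Measurable.prodMk (measurable_pi_lambda _ fun l => measurable_pi_apply _) ?_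
    exact (measurable_pi_apply i).fst
  have hy : Measurable fun z : Fin (k + 2) → 𝒳 × ℝ => (z i).2 := (measurable_pi_apply i).snd
  exact (measurable_abs.comp (hy.sub ((hμ k).comp hp))).div ((hs k).comp hp)

open Classical Finset in
/-- The number of opponents `i` that `j` beats, that is, whose leave-two-out score is smaller
than that of `j`. -/
noncomputable def winCount {𝒳 : Type*} (μ s : (m : ℕ) → (Fin m → 𝒳 × ℝ) → 𝒳 → ℝ) {k : ℕ}
    (z : Fin (k + 2) → 𝒳 × ℝ) (j : Fin (k + 2)) : ℕ :=
  #{i | i ≠ j ∧ leaveTwoOutScore μ s z i j < leaveTwoOutScore μ s z j i}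

lemma winCount_comp_perm {𝒳 : Type*} {μ s : (m : ℕ) → (Fin m → 𝒳 × ℝ) → 𝒳 → ℝ}
    (hμ : IsSymmetricAlg μ) (hs : IsSymmetricAlg s) {k : ℕ} (z : Fin (k + 2) → 𝒳 × ℝ)
    (π : Equiv.Perm (Fin (k + 2))) (j : Fin (k + 2)) :
    winCount μ s (z ∘ π) j = winCount μ s z (π j) := by
  refine Finset.card_equiv π fun i => ?_
  simp only [Finset.mem_filter_univ, π.injective.ne_iff]
  refine and_congr_right fun hij => ?_
  rw [leaveTwoOutScore_comp_perm hμ hs z π hij, leaveTwoOutScore_comp_perm hμ hs z π hij.symm]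

lemma measurable_winCount {𝒳 : Type*} [MeasurableSpace 𝒳]
    {μ s : (m : ℕ) → (Fin m → 𝒳 × ℝ) → 𝒳 → ℝ}
    (hμ : ∀ m, Measurable fun p : (Fin m → 𝒳 × ℝ) × 𝒳 => μ m p.1 p.2)
    (hs : ∀ m, Measurable fun p : (Fin m → 𝒳 × ℝ) × 𝒳 => s m p.1 p.2)
    {k : ℕ} (j : Fin (k + 2)) :
    Measurable fun z : Fin (k + 2) → 𝒳 × ℝ => winCount μ s z j := by
  classical
  simp only [winCount, Finset.card_filter]
  refine Finset.measurable_fun_sum _ fun i _ => Measurable.ite ?_ measurable_const measurable_const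
  exact (MeasurableSet.const _).inter (measurableSet_lt
    (measurable_leaveTwoOutScore hμ hs i j) (measurable_leaveTwoOutScore hμ hs j i))

/-- For exchangeable data, the probability that the point `j` wins at least `(1 - α) * (k + 2)`
comparisons is at most `2 * α`. -/
lemma measureReal_le_winCount_le {Ω 𝒳 : Type*} [MeasurableSpace Ω] [MeasurableSpace 𝒳]
    (P : Measure Ω) [IsProbabilityMeasure P] {k : ℕ} {α : ℝ} (hα : 0 ≤ α)
    {Z : Fin (k + 2) → Ω → 𝒳 × ℝ} (hZ : ∀ i, Measurable (Z i)) (hexch : Exchangeable P Z)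
    {μ s : (m : ℕ) → (Fin m → 𝒳 × ℝ) → 𝒳 → ℝ}
    (hμsymm : IsSymmetricAlg μ) (hssymm : IsSymmetricAlg s)
    (hμmeas : ∀ m, Measurable fun p : (Fin m → 𝒳 × ℝ) × 𝒳 => μ m p.1 p.2)
    (hsmeas : ∀ m, Measurable fun p : (Fin m → 𝒳 × ℝ) × 𝒳 => s m p.1 p.2) (j : Fin (k + 2)) :
    P.real {ω | (1 - α) * (k + 2) ≤ (winCount μ s (fun i => Z i ω) j : ℝ)} ≤ 2 * α := by
  classical
  let W : Fin (k + 2) → Set (Fin (k + 2) → 𝒳 × ℝ) :=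
    fun j => {z | (1 - α) * (k + 2) ≤ (winCount μ s z j : ℝ)}
  have hW : ∀ j, MeasurableSet (W j) := fun j => measurableSet_le measurable_const
    (measurable_from_nat.comp (measurable_winCount hμmeas hsmeas j))
  have hZm : Measurable fun ω i => Z i ω := measurable_pi_lambda _ hZ
  let A : Fin (k + 2) → Set Ω := fun j => (fun ω i => Z i ω) ⁻¹' W j
  have hA : ∀ j, MeasurableSet (A j) := fun j => hZm (hW j)
  have hinv : ∀ i, P.real (A i) = P.real (A j) := by
    intro i
    have h := congrArg (fun ν => ν (W j)) (hexch (Equiv.swap i j))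
    rw [Measure.map_apply (measurable_pi_lambda _ fun l => hZ _) (hW j),
      Measure.map_apply hZm (hW j)] at h
    have hset : (fun ω l => Z (Equiv.swap i j l) ω) ⁻¹' W j = A i := by
      ext ω
      have := winCount_comp_perm hμsymm hssymm (fun l => Z l ω) (Equiv.swap i j) j
      rw [Equiv.swap_apply_right] at this
      simp only [A, W, Set.mem_preimage, Set.mem_ofPred_eq, ← this]
      rfl
    rw [hset] at h
    simp only [Measure.real, h, A]
  have hcount : ∀ ω, ∑ i, (A i).indicator (1 : Ω → ℝ) ω ≤ 2 * α * (k + 2) := by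
    intro ω
    have h := card_le_of_asymm (ι := Fin (k + 2)) (c := (1 - α) * (k + 2))
      (fun j i => i ≠ j ∧ leaveTwoOutScore μ s (fun l => Z l ω) i j <
        leaveTwoOutScore μ s (fun l => Z l ω) j i)
      (fun i j h h' => lt_asymm h.2 h'.2)
      (by rw [Fintype.card_fin]; push_cast; nlinarith [(Nat.cast_nonneg k : (0 : ℝ) ≤ k)])
    rw [Fintype.card_fin] at h
    push_cast at h
    calc ∑ i, (A i).indicator (1 : Ω → ℝ) ω = _ := by
          simp only [Set.indicator_apply, Pi.one_apply, Finset.sum_boole]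
          rfl
      _ ≤ _ := h
      _ = _ := by ring
  have hsum : ∑ i, P.real (A i) ≤ 2 * α * (k + 2) := by
    have hint : ∀ i, Integrable ((A i).indicator (1 : Ω → ℝ)) P :=
      fun i => (integrable_const (1 : ℝ)).indicator (hA i)
    calc ∑ i, P.real (A i) = ∫ ω, ∑ i, (A i).indicator (1 : Ω → ℝ) ω ∂P := by
          rw [integral_finsetSum _ fun i _ => hint i]
          exact Finset.sum_congr rfl fun i _ => (integral_indicator_one (hA i)).symm
      _ ≤ ∫ _, 2 * α * (k + 2) ∂P :=
          integral_mono (integrable_finsetSum _ fun i _ => hint i) (integrable_const _) hcount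
      _ = _ := by simp
  simp only [hinv, Finset.sum_const, Finset.card_univ, Fintype.card_fin, nsmul_eq_mul] at hsum
  push_cast at hsum
  have hk : (0 : ℝ) < k + 2 := by positivity
  change P.real (A j) ≤ 2 * α
  exact le_of_mul_le_mul_right (by linarith) hk

lemma range_castSucc_comp_succAbove {k : ℕ} (i : Fin (k + 1)) :
    Set.range (Fin.castSucc ∘ i.succAbove) = {i.castSucc, Fin.last (k + 1)}ᶜ := by
  rw [Set.range_comp, Fin.range_succAbove]
  ext l
  cases l using Fin.lastCases <;> simp [Fin.castSucc_ne_last]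

/-- The test point beats every training point whose rescaled score is smaller than the
residual at the test point of the corresponding leave-one-out predictor. -/
lemma card_le_winCount_last {𝒳 : Type*} {μ s : (m : ℕ) → (Fin m → 𝒳 × ℝ) → 𝒳 → ℝ}
    (hμ : IsSymmetricAlg μ) (hs : IsSymmetricAlg s) (hspos : ∀ m d x, 0 < s m d x) {k : ℕ}
    (z : Fin (k + 2) → 𝒳 × ℝ) (T : Finset (Fin (k + 1)))
    (hT : ∀ i ∈ T,
      |(z i.castSucc).2 - μ k (z ∘ Fin.castSucc ∘ i.succAbove) (z i.castSucc).1| /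
          s k (z ∘ Fin.castSucc ∘ i.succAbove) (z i.castSucc).1 *
        s k (z ∘ Fin.castSucc ∘ i.succAbove) (z (Fin.last (k + 1))).1 <
      |(z (Fin.last (k + 1))).2 -
        μ k (z ∘ Fin.castSucc ∘ i.succAbove) (z (Fin.last (k + 1))).1|) :
    T.card ≤ winCount μ s z (Fin.last (k + 1)) := by
  classical
  rw [winCount, ← Finset.card_map Fin.castSuccEmb]
  refine Finset.card_le_card fun l hl => ?_
  obtain ⟨i, hi, rfl⟩ := Finset.mem_map.1 hl
  have hne : i.castSucc ≠ Fin.last (k + 1) := Fin.castSucc_ne_last i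
  have hinj : Function.Injective (Fin.castSucc ∘ i.succAbove) :=
    (Fin.castSucc_injective _).comp Fin.succAbove_right_injective
  refine Finset.mem_filter.2 ⟨Finset.mem_univ _, hne, ?_⟩
  rw [Fin.coe_castSuccEmb, leaveTwoOutScore_eq hμ hs z hne hinj (range_castSucc_comp_succAbove i),
    leaveTwoOutScore_eq hμ hs z hne.symm hinj
      (by rw [range_castSucc_comp_succAbove, Set.pair_comm]),
    lt_div_iff₀ (hspos _ _ _)]
  exact hT i hi

/-- **Theorem 1 (J+GP coverage).** For exchangeable data `(X_1,Y_1),…,(X_{n+2},Y_{n+2})`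
(`n = k+1` training points plus one test point), a symmetric regression algorithm `μ` and a
symmetric strictly positive dispersion estimator `s`, the J+GP interval built from the
weighted leave-one-out non-conformity scores `R_i = |Y_i - ĝ_{-i}(X_i)| / σ̂_{-i}(X_i)` has
marginal coverage at least `1 - 2α`. -/
theorem jplusGP_coverage
    {Ω 𝒳 : Type*} [MeasurableSpace Ω] [MeasurableSpace 𝒳]
    (P : Measure Ω) [IsProbabilityMeasure P]
    (k : ℕ) (α : ℝ) (hα : α ∈ Set.Ioo (0 : ℝ) 1)
    (hαn : (1 : ℝ) ≤ α * (k + 2))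
    (Z : Fin (k + 2) → Ω → 𝒳 × ℝ) (hZ : ∀ i, Measurable (Z i))
    (hexch : Exchangeable P Z)
    (μ s : (m : ℕ) → (Fin m → 𝒳 × ℝ) → 𝒳 → ℝ)
    (hμsymm : IsSymmetricAlg μ) (hssymm : IsSymmetricAlg s)
    (hμmeas : ∀ m, Measurable fun p : (Fin m → 𝒳 × ℝ) × 𝒳 => μ m p.1 p.2)
    (hsmeas : ∀ m, Measurable fun p : (Fin m → 𝒳 × ℝ) × 𝒳 => s m p.1 p.2)
    (hspos : ∀ m d x, 0 < s m d x) :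
    (1 : ℝ) - 2 * α ≤
      (P {ω |
        let D : Fin (k + 1) → 𝒳 × ℝ := fun j => Z j.castSucc ω
        let g : Fin (k + 1) → 𝒳 → ℝ := fun i => μ k (i.removeNth D)
        let σ : Fin (k + 1) → 𝒳 → ℝ := fun i => s k (i.removeNth D)
        let R : Fin (k + 1) → ℝ := fun i => |(D i).2 - g i (D i).1| / σ i (D i).1
        let x : 𝒳 := (Z (Fin.last (k + 1)) ω).1
        let y : ℝ := (Z (Fin.last (k + 1)) ω).2
        qMinus α (fun i => g i x - R i * σ i x) ≤ y ∧
          y ≤ qPlus α (fun i => g i x + R i * σ i x)}).toReal := by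
  obtain ⟨hα0, hα1⟩ := hα
  set last := Fin.last (k + 1)
  set B : Set Ω := {ω | (1 - α) * (k + 2) ≤ (winCount μ s (fun i => Z i ω) last : ℝ)}
  have hB : P.real B ≤ 2 * α :=
    measureReal_le_winCount_le P hα0.le hZ hexch hμsymm hssymm hμmeas hsmeas last
  have hcover : ∀ G : Set Ω, Gᶜ ⊆ B → 1 - 2 * α ≤ P.real G := by
    intro G hG
    have hunion : P.real Set.univ ≤ P.real G + P.real B :=
      (measureReal_mono (by
        rw [← Set.union_compl_self G]
        exact Set.union_subset_union_right _ hG)).trans (measureReal_union_le _ _)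
    rw [probReal_univ] at hunion
    linarith
  refine hcover _ fun ω hω => ?_
  simp only [Set.mem_compl_iff, Set.mem_ofPred_eq, not_and_or, not_le] at hω
  have hk : (0 : ℝ) < k + 2 := by positivity
  have hcast : (((k + 1 : ℕ) : ℝ) + 1) = k + 2 := by push_cast; ring
  have hwin := card_le_winCount_last hμsymm hssymm hspos (fun i => Z i ω)
  change (1 - α) * (k + 2) ≤ (winCount μ s (fun i => Z i ω) last : ℝ)
  rcases hω with hω | hω
  · rw [qMinus, hcast] at hω
    have hr0 : 1 ≤ ⌊α * (k + 2)⌋₊ := Nat.le_floor (by simpa using hαn)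
    have hr : ⌊α * (k + 2)⌋₊ ≤ k + 1 := by
      refine Nat.lt_succ_iff.1 ((Nat.floor_lt (by positivity)).2 ?_)
      push_cast
      nlinarith
    have hcard := (le_card_gt_of_lt_orderStat hr0 hr hω).trans
      (Nat.add_le_add_right (hwin _ fun i hi => ?_) _)
    · have hfloor := Nat.floor_le (show 0 ≤ α * ((k : ℝ) + 2) by positivity)
      have hcard' : ((k + 1 + 1 : ℕ) : ℝ) ≤ (_ : ℕ) := Nat.cast_le.2 hcard
      push_cast at hcard'
      linarith
    · have hi := (Finset.mem_filter.1 hi).2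
      exact lt_of_lt_of_le (lt_sub_comm.1 hi) ((le_abs_self _).trans_eq (abs_sub_comm _ _))
  · rw [qPlus, hcast] at hω
    have hr : ⌈(1 - α) * ((k : ℝ) + 2)⌉₊ ≤ k + 1 := by
      refine Nat.ceil_le.2 ?_
      push_cast
      linarith
    have hcard := (le_card_lt_of_orderStat_lt hr hω).trans (hwin _ fun i hi => ?_)
    · exact Nat.ceil_le.1 hcard
    · have hi := (Finset.mem_filter.1 hi).2
      exact lt_of_lt_of_le (lt_sub_iff_add_lt'.2 hi) (le_abs_self _)
end

section
/- Let 𝒳 be a measurable space, let n ≥ 1 and α ∈ (0,1) with α(n+1) ≥ 1, and let (X_1,Y_1),…,(X_{n+1},Y_{n+1}) be exchangeable random variables with values in 𝒳 × ℝ. Let μ be a symmetric regression algorithm, let ĝ_{-i} = μ({(X_1,Y_1),…,(X_n,Y_n)} ∖ {(X_i,Y_i)}) be the leave-one-out predictors, and let R_i^{LOO} = |Y_i − ĝ_{-i}(X_i)| be the leave-one-out residuals, for i = 1,…,n. Define the Jackknife+ prediction interval Ĉ(X_{n+1}) = [ q̂⁻_{n,α}{ ĝ_{-i}(X_{n+1})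 − R_i^{LOO} } , q̂⁺_{n,α}{ ĝ_{-i}(X_{n+1}) + R_i^{LOO} } ]. Then ℙ( Y_{n+1} ∈ Ĉ(X_{n+1}) ) ≥ 1 − 2α. -/
open MeasureTheory

/-- If the `m`-th smallest value lies strictly above `y`, at least `n + 1 - m` values do. -/
theorem le_card_of_lt_orderStat {n : ℕ} (v : Fin n → ℝ) {m : ℕ} (hm : 1 ≤ m) (hmn : m ≤ n)
    {y : ℝ} (hy : y < orderStat v m) :
    n + 1 ≤ (Finset.univ.filter fun i => y < v i).card + m := by
  have h : m - 1 < n := by omega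
  rw [orderStat, dif_pos h] at hy
  have hsub : (Finset.Ici (⟨m - 1, h⟩ : Fin n)).map (Tuple.sort v).toEmbedding ⊆
      Finset.univ.filter fun i => y < v i := by
    intro i hi
    obtain ⟨j, hj, rfl⟩ := Finset.mem_map.1 hi
    exact Finset.mem_filter.2 ⟨Finset.mem_univ _,
      hy.trans_le (Tuple.monotone_sort v (Finset.mem_Ici.1 hj))⟩
  have hcard := Finset.card_le_card hsub
  rw [Finset.card_map, Fin.card_Ici] at hcard
  simp only at hcard
  omega

/-- If the `m`-th smallest value lies strictly below `y`, at least `m` values do. -/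
theorem le_card_of_orderStat_lt {n : ℕ} (v : Fin n → ℝ) {m : ℕ} (hm : 1 ≤ m) (hmn : m ≤ n)
    {y : ℝ} (hy : orderStat v m < y) :
    m ≤ (Finset.univ.filter fun i => v i < y).card := by
  have h : m - 1 < n := by omega
  rw [orderStat, dif_pos h] at hy
  have hsub : (Finset.Iic (⟨m - 1, h⟩ : Fin n)).map (Tuple.sort v).toEmbedding ⊆
      Finset.univ.filter fun i => v i < y := by
    intro i hi
    obtain ⟨j, hj, rfl⟩ := Finset.mem_map.1 hi
    exact Finset.mem_filter.2 ⟨Finset.mem_univ _,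
      (Tuple.monotone_sort v (Finset.mem_Iic.1 hj)).trans_lt hy⟩
  have hcard := Finset.card_le_card hsub
  rw [Finset.card_map, Fin.card_Iic] at hcard
  simp only at hcard
  omega

/-- If `y` lies strictly below the `α`-empirical quantile, then at least `(1 - α) (n + 1)` of the
values lie strictly above `y`. -/
theorem le_card_of_lt_qMinus {n : ℕ} {α : ℝ} (hα1 : α < 1) (hαn : 1 ≤ α * (n + 1))
    (v : Fin n → ℝ) {y : ℝ} (hy : y < qMinus α v) :
    (1 - α) * (n + 1) ≤ ((Finset.univ.filter fun i => y < v i).card : ℝ) := by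
  have hfloor : (⌊α * (n + 1)⌋₊ : ℝ) ≤ α * (n + 1) := Nat.floor_le (by linarith)
  have hlt : ⌊α * (n + 1)⌋₊ < n + 1 := by
    have hn : (0 : ℝ) ≤ n := n.cast_nonneg
    have : (⌊α * (n + 1)⌋₊ : ℝ) < ((n + 1 : ℕ) : ℝ) := by push_cast; nlinarith
    exact_mod_cast this
  have hcard := le_card_of_lt_orderStat v (Nat.le_floor (by exact_mod_cast hαn))
    (Nat.lt_succ_iff.1 hlt) hy
  have hcard' : (n : ℝ) + 1 ≤ (Finset.univ.filter fun i => y < v i).card +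
      (⌊α * (n + 1)⌋₊ : ℝ) := by exact_mod_cast hcard
  linarith

/-- If `y` lies strictly above the `(1 - α)`-empirical quantile, then at least `(1 - α) (n + 1)` of
the values lie strictly below `y`. -/
theorem le_card_of_qPlus_lt {n : ℕ} {α : ℝ} (hα1 : α < 1) (hαn : 1 ≤ α * (n + 1))
    (v : Fin n → ℝ) {y : ℝ} (hy : qPlus α v < y) :
    (1 - α) * (n + 1) ≤ ((Finset.univ.filter fun i => v i < y).card : ℝ) := by
  have hn : (0 : ℝ) ≤ n := n.cast_nonneg
  have hpos : 1 ≤ ⌈(1 - α) * (n + 1)⌉₊ :=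
    Nat.ceil_pos.2 (mul_pos (by linarith) (by linarith))
  have hle : ⌈(1 - α) * (n + 1)⌉₊ ≤ n := Nat.ceil_le.2 (by linarith)
  exact (Nat.le_ceil _).trans (by exact_mod_cast le_card_of_orderStat_lt v hpos hle hy)

/-- In a tournament in which `i` beats `j` when `r j i < r i j`, at most `2 (N - c)` of the `N`
players beat at least `c` others. -/
theorem card_filter_le_card_wins_le {ι : Type*} [Fintype ι] (r : ι → ι → ℝ) {c : ℝ}
    (hc : c ≤ Fintype.card ι) :
    ((Finset.univ.filter fun i =>
      c ≤ ((Finset.univ.filter fun j => r j i < r i j).card : ℝ)).card : ℝ) ≤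
      2 * (Fintype.card ι - c) := by
  classical
  set S := Finset.univ.filter fun i =>
    c ≤ ((Finset.univ.filter fun j => r j i < r i j).card : ℝ)
  set w : ι → ι → ℝ := fun i j => if r j i < r i j then 1 else 0 with hw
  have hwins (i : ι) : ((Finset.univ.filter fun j => r j i < r i j).card : ℝ) = ∑ j, w i j := by
    simp [hw]
  have hlower : (S.card : ℝ) * c ≤ ∑ i ∈ S, ∑ j, w i j := by
    rw [← nsmul_eq_mul]
    refine Finset.card_nsmul_le_sum _ _ _ fun i hi => ?_
    rw [← hwins]
    exact (Finset.mem_filter.1 hi).2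
  have hinner : 2 * ∑ i ∈ S, ∑ j ∈ S, w i j ≤ (S.card : ℝ) * S.card := by
    calc 2 * ∑ i ∈ S, ∑ j ∈ S, w i j
        = ∑ i ∈ S, ∑ j ∈ S, (w i j + w j i) := by
          simp only [Finset.sum_add_distrib]
          rw [Finset.sum_comm (f := fun i j => w j i), two_mul]
      _ ≤ ∑ i ∈ S, ∑ j ∈ S, (1 : ℝ) := by
          refine Finset.sum_le_sum fun i _ => Finset.sum_le_sum fun j _ => ?_
          simp only [hw]
          split_ifs <;> linarith
      _ = (S.card : ℝ) * S.card := by simp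
  have houter : ∑ i ∈ S, ∑ j ∈ Sᶜ, w i j ≤ (S.card : ℝ) * (Fintype.card ι - S.card) := by
    calc ∑ i ∈ S, ∑ j ∈ Sᶜ, w i j ≤ ∑ i ∈ S, ∑ j ∈ Sᶜ, (1 : ℝ) := by
          refine Finset.sum_le_sum fun i _ => Finset.sum_le_sum fun j _ => ?_
          simp only [hw]
          split_ifs <;> norm_num
      _ = (S.card : ℝ) * (Fintype.card ι - S.card) := by
          simp [Finset.card_compl, Nat.cast_sub (Finset.card_le_univ S), mul_sub]
  have hsplit : ∑ i ∈ S, ∑ j, w i j = ∑ i ∈ S, ∑ j ∈ S, w i j + ∑ i ∈ S, ∑ j ∈ Sᶜ, w i j := by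
    rw [← Finset.sum_add_distrib]
    exact Finset.sum_congr rfl fun i _ => (Finset.sum_add_sum_compl S _).symm
  rcases (Nat.cast_nonneg (α := ℝ) S.card).eq_or_lt with h0 | hpos
  · rw [← h0]
    linarith
  · have : (S.card : ℝ) * S.card ≤ S.card * (2 * (Fintype.card ι - c)) := by nlinarith
    exact le_of_mul_le_mul_left this hpos

/-- For exchangeable players, whose pairwise scores are an equivariant function of the data, each
fixed player beats at least `(1 - α) m` others with probability at most `2 α`. -/
theorem Exchangeable.measure_le_card_wins_le {Ω E : Type*} [MeasurableSpace Ω] [MeasurableSpace E]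
    {P : Measure Ω} [IsProbabilityMeasure P] {m : ℕ} {Z : Fin m → Ω → E}
    (hexch : Exchangeable P Z) (hZ : ∀ i, Measurable (Z i))
    {ρ : (Fin m → E) → Fin m → Fin m → ℝ} (hρ : ∀ i j, Measurable fun z => ρ z i j)
    (hequiv : ∀ z (π : Equiv.Perm (Fin m)) i j, ρ (z ∘ π) i j = ρ z (π i) (π j))
    {α : ℝ} (hα : 0 ≤ α) (a : Fin m) :
    P {ω | (1 - α) * m ≤ ((Finset.univ.filter fun j =>
      ρ (fun i => Z i ω) j a < ρ (fun i => Z i ω) a j).card : ℝ)} ≤ ENNReal.ofReal (2 * α) := by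
  set wins : (Fin m → E) → Fin m → ℝ := fun z i =>
    ((Finset.univ.filter fun j => ρ z j i < ρ z i j).card : ℝ) with hwins
  set S : Fin m → Set (Fin m → E) := fun i => {z | (1 - α) * m ≤ wins z i} with hSdef
  have hZm : Measurable fun ω i => Z i ω := measurable_pi_lambda _ hZ
  have hwinsm (i : Fin m) : Measurable fun z => wins z i := by
    simp only [hwins, Finset.card_filter, Nat.cast_sum]
    refine Finset.measurable_sum _ fun j _ => ?_
    exact (measurable_from_top (f := fun x : ℕ => (x : ℝ))).comp
      (Measurable.ite (measurableSet_lt (hρ j i) (hρ i j)) measurable_const measurable_const)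
  have hSm (i : Fin m) : MeasurableSet (S i) := measurableSet_le measurable_const (hwinsm i)
  have hwins_perm (z : Fin m → E) (π : Equiv.Perm (Fin m)) (i : Fin m) :
      wins (z ∘ π) i = wins z (π i) := by
    simp only [hwins, hequiv]
    congr 1
    exact Finset.card_bij (fun j _ => π j) (by simp) (fun _ _ _ _ h => π.injective h)
      fun j hj => ⟨π.symm j, by simpa using hj, by simp⟩
  set Q := P.map fun ω i => Z i ω with hQ
  have : IsProbabilityMeasure Q := Measure.isProbabilityMeasure_map hZm.aemeasurable
  have hQS (i : Fin m) : Q (S i) = Q (S a) := by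
    have hπ := hexch (Equiv.swap i a)
    rw [hQ, ← hπ, Measure.map_apply (measurable_pi_lambda _ fun j => hZ _) (hSm i), hπ,
      Measure.map_apply hZm (hSm a)]
    congr 1
    ext ω
    have := hwins_perm (fun i => Z i ω) (Equiv.swap i a) i
    rw [Equiv.swap_apply_left] at this
    exact iff_of_eq (congrArg ((1 - α) * m ≤ ·) this)
  have hpos : (0 : ℝ) < m := by exact_mod_cast a.pos
  have hsum : (m : ENNReal) * Q (S a) ≤ m * ENNReal.ofReal (2 * α) := by
    calc (m : ENNReal) * Q (S a) = ∑ i, Q (S i) := by simp [hQS]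
      _ = ∑ i, ∫⁻ z, (S i).indicator 1 z ∂Q := by simp only [lintegral_indicator_one (hSm _)]
      _ = ∫⁻ z, ∑ i, (S i).indicator 1 z ∂Q :=
          (lintegral_finsetSum _ fun i _ => measurable_one.indicator (hSm i)).symm
      _ ≤ ∫⁻ _, ENNReal.ofReal (m * (2 * α)) ∂Q := by
          refine lintegral_mono fun z => ?_
          have hcard := card_filter_le_card_wins_le (ρ z) (c := (1 - α) * m)
            (by rw [Fintype.card_fin]; nlinarith)
          rw [Fintype.card_fin] at hcard
          have hind : ∑ i, (S i).indicator (1 : (Fin m → E) → ENNReal) z =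
              ((Finset.univ.filter fun i => (1 - α) * m ≤ wins z i).card : ENNReal) := by
            simp [Set.indicator_apply, hSdef]
          simp only [hind]
          rw [← ENNReal.ofReal_natCast]
          exact ENNReal.ofReal_le_ofReal (hcard.trans_eq (by ring))
      _ = m * ENNReal.ofReal (2 * α) := by
          simp [ENNReal.ofReal_mul hpos.le]
  have hQa : Q (S a) ≤ ENNReal.ofReal (2 * α) :=
    (ENNReal.mul_le_mul_iff_right (by exact_mod_cast a.pos.ne') (ENNReal.natCast_ne_top m)).1 hsum
  rwa [hQ, Measure.map_apply hZm (hSm a)] at hQa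

/-- A symmetric algorithm trained on an injectively indexed subsample depends only on the set of
indices used. -/
theorem IsSymmetricAlg.comp_eq_of_range_eq {𝒳 ι : Type*}
    {μ : (m : ℕ) → (Fin m → 𝒳 × ℝ) → 𝒳 → ℝ} (hμ : IsSymmetricAlg μ) {k : ℕ} (z : ι → 𝒳 × ℝ)
    {e f : Fin k → ι} (he : Function.Injective e) (hf : Function.Injective f)
    (hef : Set.range e = Set.range f) : μ k (z ∘ e) = μ k (z ∘ f) := by
  let π : Equiv.Perm (Fin k) := (Equiv.ofInjective e he).trans
    ((Equiv.setCongr hef).trans (Equiv.ofInjective f hf).symm)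
  have hπ : f ∘ π = e := by
    ext1 i
    simp [π, Equiv.apply_ofInjective_symm]
  rw [← hπ, ← Function.comp_assoc, hμ]

/-- The complement of two distinct indices in `Fin (k + 2)` can be enumerated by `Fin k`. -/
theorem exists_injective_range_eq_compl_pair (k : ℕ) :
    ∃ e : Fin (k + 2) → Fin (k + 2) → Fin k → Fin (k + 2),
      ∀ i j, i ≠ j → Function.Injective (e i j) ∧ Set.range (e i j) = {i, j}ᶜ := by
  have h (i j : Fin (k + 2)) : ∃ e : Fin k → Fin (k + 2),
      i ≠ j → Function.Injective e ∧ Set.range e = {i, j}ᶜ := by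
    by_cases hij : i = j
    · exact ⟨fun _ => i, fun h => absurd hij h⟩
    · have hcard : (({i, j} : Finset (Fin (k + 2)))ᶜ).card = k := by
        rw [Finset.card_compl, Finset.card_pair hij, Fintype.card_fin, Nat.add_sub_cancel]
      exact ⟨_, fun _ => ⟨(Finset.orderEmbOfFin _ hcard).injective, by
        rw [Finset.range_orderEmbOfFin, Finset.coe_compl, Finset.coe_pair]⟩⟩
  choose e he using h
  exact ⟨e, he⟩

/-- **Jackknife+ coverage.** For exchangeable data (`k+1` training points plus one test
point) and a symmetric regression algorithm `μ`, the Jackknife+ interval built from the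
leave-one-out residuals `R_i = |Y_i - ĝ_{-i}(X_i)|` has marginal coverage at least
`1 - 2α`. -/
theorem jackknifePlus_coverage
    {Ω 𝒳 : Type*} [MeasurableSpace Ω] [MeasurableSpace 𝒳]
    (P : Measure Ω) [IsProbabilityMeasure P]
    (k : ℕ) (α : ℝ) (hα : α ∈ Set.Ioo (0 : ℝ) 1)
    (hαn : (1 : ℝ) ≤ α * (k + 2))
    (Z : Fin (k + 2) → Ω → 𝒳 × ℝ) (hZ : ∀ i, Measurable (Z i))
    (hexch : Exchangeable P Z)
    (μ : (m : ℕ) → (Fin m → 𝒳 × ℝ) → 𝒳 → ℝ)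
    (hμsymm : IsSymmetricAlg μ)
    (hμmeas : ∀ m, Measurable fun p : (Fin m → 𝒳 × ℝ) × 𝒳 => μ m p.1 p.2) :
    (1 : ℝ) - 2 * α ≤
      (P {ω |
        let D : Fin (k + 1) → 𝒳 × ℝ := fun j => Z j.castSucc ω
        let g : Fin (k + 1) → 𝒳 → ℝ := fun i => μ k (i.removeNth D)
        let R : Fin (k + 1) → ℝ := fun i => |(D i).2 - g i (D i).1|
        let x : 𝒳 := (Z (Fin.last (k + 1)) ω).1
        let y : ℝ := (Z (Fin.last (k + 1)) ω).2
        qMinus α (fun i => g i x - R i) ≤ y ∧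
          y ≤ qPlus α (fun i => g i x + R i)}).toReal := by
  obtain ⟨e, he⟩ := exists_injective_range_eq_compl_pair k
  -- Residual at `i` of the predictor trained without `i` and `j`.
  let ρ : (Fin (k + 2) → 𝒳 × ℝ) → Fin (k + 2) → Fin (k + 2) → ℝ := fun z i j =>
    if i = j then 0 else |(z i).2 - μ k (z ∘ e i j) (z i).1|
  have hρm (i j : Fin (k + 2)) : Measurable fun z => ρ z i j := by
    by_cases hij : i = j
    · simp [ρ, hij]
    · simp only [ρ, hij, if_false]
      have hpred : Measurable fun z : Fin (k + 2) → 𝒳 × ℝ => μ k (z ∘ e i j) (z i).1 :=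
        (hμmeas k).comp (Measurable.prodMk
          (measurable_pi_lambda _ fun l => measurable_pi_apply (e i j l))
          (measurable_pi_apply i).fst)
      exact ((measurable_pi_apply i).snd.sub hpred).abs
  have hρ_eq (z : Fin (k + 2) → 𝒳 × ℝ) {i j : Fin (k + 2)} (hij : i ≠ j)
      {f : Fin k → Fin (k + 2)} (hf : Function.Injective f) (hrange : Set.range f = {i, j}ᶜ) :
      ρ z i j = |(z i).2 - μ k (z ∘ f) (z i).1| := by
    simp only [ρ, hij, if_false]
    rw [hμsymm.comp_eq_of_range_eq z (he i j hij).1 hf ((he i j hij).2.trans hrange.symm)]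
  have hequiv (z : Fin (k + 2) → 𝒳 × ℝ) (π : Equiv.Perm (Fin (k + 2))) (i j : Fin (k + 2)) :
      ρ (z ∘ π) i j = ρ z (π i) (π j) := by
    by_cases hij : i = j
    · simp [ρ, hij]
    · rw [hρ_eq z (π.injective.ne hij) (π.injective.comp (he i j hij).1)
        (by rw [Set.range_comp, (he i j hij).2, Set.image_compl_eq π.bijective, Set.image_pair])]
      simp [ρ, hij, Function.comp_assoc]
  have hbound := hexch.measure_le_card_wins_le hZ hρm hequiv hα.1.le (Fin.last (k + 1))
  set B := {ω | (1 - α) * ((k + 2 : ℕ) : ℝ) ≤ ((Finset.univ.filter fun j =>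
      ρ (fun i => Z i ω) j (Fin.last (k + 1)) <
        ρ (fun i => Z i ω) (Fin.last (k + 1)) j).card : ℝ)}
  have hαn' : 1 ≤ α * (((k + 1 : ℕ) : ℝ) + 1) := by
    push_cast
    linarith
  have hcast : (1 - α) * (((k + 1 : ℕ) : ℝ) + 1) = (1 - α) * ((k + 2 : ℕ) : ℝ) := by
    push_cast
    ring
  set G := {ω |
    let D : Fin (k + 1) → 𝒳 × ℝ := fun j => Z j.castSucc ω
    let g : Fin (k + 1) → 𝒳 → ℝ := fun i => μ k (i.removeNth D)
    let R : Fin (k + 1) → ℝ := fun i => |(D i).2 - g i (D i).1|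
    let x : 𝒳 := (Z (Fin.last (k + 1)) ω).1
    let y : ℝ := (Z (Fin.last (k + 1)) ω).2
    qMinus α (fun i => g i x - R i) ≤ y ∧ y ≤ qPlus α (fun i => g i x + R i)} with hG
  have hGB : Gᶜ ⊆ B := by
    intro ω hω
    rw [Set.mem_compl_iff, hG, Set.mem_ofPred_eq] at hω
    extract_lets D g R x y at hω
    have hinj (i : Fin (k + 1)) : Function.Injective (Fin.castSucc ∘ i.succAbove) :=
      (Fin.castSucc_injective _).comp Fin.succAbove_right_injective
    have hrange (i : Fin (k + 1)) :
        Set.range (Fin.castSucc ∘ i.succAbove) = {i.castSucc, Fin.last (k + 1)}ᶜ := by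
      ext j
      induction j using Fin.lastCases with
      | last => simp
      | cast j => simp [Fin.exists_succAbove_eq_iff]
    have htrain (i : Fin (k + 1)) : ρ (fun i => Z i ω) i.castSucc (Fin.last (k + 1)) = R i :=
      hρ_eq (fun i => Z i ω) (Fin.castSucc_lt_last i).ne (hinj i) (hrange i)
    have htest (i : Fin (k + 1)) :
        ρ (fun i => Z i ω) (Fin.last (k + 1)) i.castSucc = |y - g i x| :=
      hρ_eq (fun i => Z i ω) (Fin.castSucc_lt_last i).ne' (hinj i)
        ((hrange i).trans (by rw [Set.pair_comm]))
    have hmem {p : Fin (k + 1) → Prop} [DecidablePred p] (hp : ∀ i, p i → R i < |y - g i x|)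
        (hcard : (1 - α) * (((k + 1 : ℕ) : ℝ) + 1) ≤ ((Finset.univ.filter p).card : ℝ)) :
        ω ∈ B := by
      rw [hcast] at hcard
      refine hcard.trans (Nat.cast_le.2 (Finset.card_le_card_of_injOn Fin.castSucc ?_
        (Fin.castSucc_injective _).injOn))
      intro i hi
      have hi' : p i := by simpa using hi
      simpa [htrain, htest] using hp i hi'
    rcases not_and_or.1 hω with h | h
    · refine hmem (fun i hi => ?_) (le_card_of_lt_qMinus hα.2 hαn' _ (not_le.1 h))
      rw [abs_sub_comm]
      exact lt_of_lt_of_le (by linarith) (le_abs_self _)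
    · refine hmem (fun i hi => ?_) (le_card_of_qPlus_lt hα.2 hαn' _ (not_le.1 h))
      exact lt_of_lt_of_le (by linarith) (le_abs_self _)
  have hcover : 1 ≤ P G + ENNReal.ofReal (2 * α) := by
    calc 1 = P (G ∪ Gᶜ) := by rw [Set.union_compl_self, measure_univ]
      _ ≤ P G + P Gᶜ := measure_union_le _ _
      _ ≤ P G + ENNReal.ofReal (2 * α) := by gcongr; exact (measure_mono hGB).trans hbound
  have hreal := ENNReal.toReal_mono
    (ENNReal.add_ne_top.2 ⟨measure_ne_top P G, ENNReal.ofReal_ne_top⟩) hcover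
  rw [ENNReal.toReal_add (measure_ne_top P G) ENNReal.ofReal_ne_top,
    ENNReal.toReal_ofReal (by linarith [hα.1]), ENNReal.toReal_one] at hreal
  linarith
end

section
/- Let n ≥ 1 and α ∈ (0,1). Let (R̃_{ij})_{i ≠ j, 1 ≤ i,j ≤ n+1} be real numbers that are pairwise distinct, and for each i set m_i = min_{j ≠ i} R̃_{ij}. Define the (n+1) × (n+1) matrix A with entries in {0,1} by A_{ii} = 0 and, for i ≠ j, A_{ij} = 1{ m_i ≥ R̃_{ji} }. Define the strange set S(A) = { i ∈ {1,…,n+1} : Σ_{j=1}^{n+1} A_{ij} ≥ (1−α)(n+1) }. Then the cardinality of S(A) satisfies |S(A)| ≤ α(n+1). -/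
/-- **Strange-set bound for the Jackknife-minmax/J-minmax-GP proof.** Let `R i j`
(for `i ≠ j`) be pairwise distinct reals, let `m i = min_{j ≠ i} R i j`, and define the
`{0,1}`-matrix `A` with zero diagonal and, for `i ≠ j`, `A i j = 1{ m i ≥ R j i }`.
Then the set of "strange" points, i.e. the indices `i` whose row sum is at least
`(1-α)(n+1)`, has cardinality at most `α(n+1)`. -/
theorem strange_set_card_le_jackknifeMinmax
    (n : ℕ) (hn : 1 ≤ n) (α : ℝ) (hα : α ∈ Set.Ioo (0 : ℝ) 1)
    (R : Fin (n + 1) → Fin (n + 1) → ℝ)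
    (hdist : ∀ i j i' j', i ≠ j → i' ≠ j' → (i, j) ≠ (i', j') → R i j ≠ R i' j')
    (m : Fin (n + 1) → ℝ)
    (hm : ∀ i, IsLeast {r | ∃ j, j ≠ i ∧ r = R i j} (m i))
    (A : Matrix (Fin (n + 1)) (Fin (n + 1)) ℝ)
    (hAdiag : ∀ i, A i i = 0)
    (hA : ∀ i j, i ≠ j → A i j = if R j i ≤ m i then 1 else 0) :
    (({i : Fin (n + 1) | (1 - α) * (n + 1) ≤ ∑ j, A i j}.ncard : ℝ)) ≤ α * (n + 1) := by
  classical
  obtain ⟨hα0, -⟩ := hα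
  set S : Finset (Fin (n + 1)) :=
    Finset.univ.filter fun i => (1 - α) * (n + 1) ≤ ∑ j, A i j with hS
  have hcoe : {i : Fin (n + 1) | (1 - α) * (n + 1) ≤ ∑ j, A i j} = (S : Set (Fin (n + 1))) := by
    ext i
    simp [hS]
  rw [hcoe, Set.ncard_coe_finset]
  rcases S.eq_empty_or_nonempty with hempty | hne
  · rw [hempty, Finset.card_empty, Nat.cast_zero]
    positivity
  obtain ⟨i, hiS, hmin⟩ := S.exists_min_image m hne
  have hstrange : (1 - α) * (n + 1) ≤ ∑ j, A i j := (Finset.mem_filter.mp hiS).2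
  have hentry : ∀ j, A i j ≤ 1 - if j ∈ S then 1 else 0 := by
    intro j
    rcases eq_or_ne i j with rfl | hij
    · simp [hAdiag, hiS]
    rw [hA i j hij]
    by_cases hjS : j ∈ S
    · have hlose : ¬ R j i ≤ m i := by
        intro hle
        have hge : m i ≤ R j i := (hmin j hjS).trans ((hm j).2 ⟨i, hij, rfl⟩)
        obtain ⟨k, hki, hk⟩ := (hm i).1
        exact hdist j i i k hij.symm hki.symm (fun h => hij (congrArg Prod.fst h).symm)
          ((le_antisymm hle hge).trans hk)
      simp [hlose, hjS]
    · rw [if_neg hjS, sub_zero]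
      split_ifs <;> norm_num
  have hrow : ∑ j, A i j ≤ (n + 1 : ℝ) - S.card := by
    refine (Finset.sum_le_sum fun j _ => hentry j).trans_eq ?_
    simp [Finset.sum_sub_distrib]
  linarith
end

section
/- Let n ≥ 1 and α ∈ (0,1) with α(n+1) ≥ 1, and let a_1,…,a_n, b_1,…,b_n and y be real numbers. If y > q̂⁺_{n,α}{ a_i + b_i } or y < q̂⁻_{n,α}{ a_i − b_i }, then the number of indices i ∈ {1,…,n} with |y − a_i| > b_i is at least ⌈(1−α)(n+1)⌉. -/
/-- If `y` exceeds the `k`-th smallest of `n` values, then at least `k` of them are below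
`y`. -/
theorem le_ncard_lt_of_orderStat_lt {n k : ℕ} (v : Fin n → ℝ) (y : ℝ) (hk : 1 ≤ k)
    (hkn : k ≤ n) (hy : orderStat v k < y) : k ≤ {i | v i < y}.ncard := by
  have h : k - 1 < n := by omega
  rw [orderStat, dif_pos h] at hy
  have hsub : Tuple.sort v '' Set.Iic ⟨k - 1, h⟩ ⊆ {i | v i < y} := by
    rintro _ ⟨j, hj, rfl⟩
    exact (Tuple.monotone_sort v hj).trans_lt hy
  have hcard := Set.ncard_le_ncard hsub (Set.toFinite _)
  rw [Set.ncard_image_of_injective _ (Tuple.sort v).injective, ← Finset.coe_Iic,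
    Set.ncard_coe_finset, Fin.card_Iic] at hcard
  dsimp only at hcard
  omega

/-- If `y` is below the `k`-th smallest of `n` values, then at least `n + 1 - k` of them
exceed `y`. -/
theorem le_ncard_gt_of_lt_orderStat {n k : ℕ} (v : Fin n → ℝ) (y : ℝ) (hk : 1 ≤ k)
    (hkn : k ≤ n) (hy : y < orderStat v k) : n + 1 - k ≤ {i | y < v i}.ncard := by
  have h : k - 1 < n := by omega
  rw [orderStat, dif_pos h] at hy
  have hsub : Tuple.sort v '' Set.Ici ⟨k - 1, h⟩ ⊆ {i | y < v i} := by
    rintro _ ⟨j, hj, rfl⟩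
    exact hy.trans_le (Tuple.monotone_sort v hj)
  have hcard := Set.ncard_le_ncard hsub (Set.toFinite _)
  rw [Set.ncard_image_of_injective _ (Tuple.sort v).injective, ← Finset.coe_Ici,
    Set.ncard_coe_finset, Fin.card_Ici] at hcard
  dsimp only at hcard
  omega

/-- **Outside the Jackknife+/J+GP interval means many violated comparisons.** If
`y > q̂⁺_{n,α}{a_i + b_i}` or `y < q̂⁻_{n,α}{a_i - b_i}`, then the number of indices `i`
with `|y - a_i| > b_i` is at least `⌈(1-α)(n+1)⌉`. -/
theorem outside_jackknifePlus_interval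
    (n : ℕ) (hn : 1 ≤ n) (α : ℝ) (hα : α ∈ Set.Ioo (0 : ℝ) 1)
    (hαn : (1 : ℝ) ≤ α * (n + 1))
    (a b : Fin n → ℝ) (y : ℝ)
    (hy : qPlus α (fun i => a i + b i) < y ∨ y < qMinus α (fun i => a i - b i)) :
    ⌈(1 - α) * (n + 1)⌉₊ ≤ {i : Fin n | b i < |y - a i|}.ncard := by
  obtain ⟨hα0, hα1⟩ := hα
  have hpos : (0 : ℝ) < n + 1 := by positivity
  rcases hy with hy | hy
  · have hk : 1 ≤ ⌈(1 - α) * (n + 1)⌉₊ :=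
      Nat.ceil_pos.2 (mul_pos (sub_pos.2 hα1) hpos)
    have hkn : ⌈(1 - α) * (n + 1)⌉₊ ≤ n := Nat.ceil_le.2 (by linarith)
    refine (le_ncard_lt_of_orderStat_lt _ y hk hkn hy).trans
      (Set.ncard_le_ncard (fun i hi => ?_) (Set.toFinite _))
    simp only [Set.mem_ofPred_eq] at hi ⊢
    exact lt_abs.2 (Or.inl (by linarith))
  · have hm : 1 ≤ ⌊α * (n + 1)⌋₊ := Nat.le_floor (by exact_mod_cast hαn)
    have hmn : ⌊α * (n + 1)⌋₊ ≤ n := by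
      refine Nat.lt_succ_iff.1 ((Nat.floor_lt (by positivity)).2 ?_)
      push_cast
      nlinarith
    have hceil : ⌈(1 - α) * (n + 1)⌉₊ ≤ n + 1 - ⌊α * (n + 1)⌋₊ := by
      refine Nat.ceil_le.2 ?_
      have hfloor := Nat.floor_le (show 0 ≤ α * ((n : ℝ) + 1) by positivity)
      rw [Nat.cast_sub (by omega)]
      push_cast
      linarith
    refine (hceil.trans (le_ncard_gt_of_lt_orderStat _ y hm hmn hy)).trans
      (Set.ncard_le_ncard (fun i hi => ?_) (Set.toFinite _))
    simp only [Set.mem_ofPred_eq] at hi ⊢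
    exact lt_abs.2 (Or.inr (by linarith))
end

section
/- Let n ≥ 1 and α ∈ (0,1) with α(n+1) ≥ 1, let a_1,…,a_n be real numbers, let c_1,…,c_n be nonnegative real numbers, and let y be a real number. If y < min_{i=1,…,n} a_i − q̂⁺_{n,α}{ c_i } or y > max_{i=1,…,n} a_i + q̂⁺_{n,α}{ c_i }, then the number of indices i ∈ {1,…,n} with min_{j=1,…,n} |y − a_j| > c_i is at least ⌈(1−α)(n+1)⌉. -/
theorem le_ncard_of_orderStat_lt {n : ℕ} (v : Fin n → ℝ) {k : ℕ} (hk : k ≤ n) {t : ℝ}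
    (ht : orderStat v k < t) : k ≤ {i : Fin n | v i < t}.ncard := by
  rcases Nat.eq_zero_or_pos k with rfl | hpos
  · exact Nat.zero_le _
  have hlt : k - 1 < n := by omega
  rw [orderStat, dif_pos hlt] at ht
  have hinj : Function.Injective fun j : Fin k => Tuple.sort v (Fin.castLE hk j) :=
    (Tuple.sort v).injective.comp (Fin.castLE_injective hk)
  have hsub : Set.range (fun j : Fin k => Tuple.sort v (Fin.castLE hk j)) ⊆
      {i : Fin n | v i < t} := by
    rintro _ ⟨j, rfl⟩
    have hj : Fin.castLE hk j ≤ ⟨k - 1, hlt⟩ := Fin.mk_le_mk.2 (by omega)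
    exact (Tuple.monotone_sort v hj).trans_lt ht
  calc k = (Set.range fun j : Fin k => Tuple.sort v (Fin.castLE hk j)).ncard := by
        rw [← Set.image_univ, Set.ncard_image_of_injective _ hinj, Set.ncard_univ,
          Nat.card_eq_fintype_card, Fintype.card_fin]
    _ ≤ _ := Set.ncard_le_ncard hsub (Set.toFinite _)

theorem lt_iInf_abs_sub_of_outside {ι : Type*} [Finite ι] [Nonempty ι] (a : ι → ℝ) {q y : ℝ}
    (hy : y < (⨅ i, a i) - q ∨ (⨆ i, a i) + q < y) : q < ⨅ j, |y - a j| := by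
  obtain ⟨j, hj⟩ := exists_eq_ciInf_of_finite (f := fun j => |y - a j|)
  rw [← hj]
  rcases hy with hy | hy
  · have := ciInf_le (Set.finite_range a).bddBelow j
    linarith [neg_le_abs (y - a j)]
  · have := le_ciSup (Set.finite_range a).bddAbove j
    linarith [le_abs_self (y - a j)]

/-- **Outside the Jackknife-minmax/J-minmax-GP interval means many violated comparisons.**
If `y < min_i a_i - q̂⁺_{n,α}{c_i}` or `y > max_i a_i + q̂⁺_{n,α}{c_i}` (with `c_i ≥ 0`),
then the number of indices `i` with `min_j |y - a_j| > c_i` is at least `⌈(1-α)(n+1)⌉`. -/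
theorem outside_jackknifeMinmax_interval
    (n : ℕ) (hn : 1 ≤ n) (α : ℝ) (hα : α ∈ Set.Ioo (0 : ℝ) 1)
    (hαn : (1 : ℝ) ≤ α * (n + 1))
    (a c : Fin n → ℝ) (hc : ∀ i, 0 ≤ c i) (y : ℝ)
    (hy : y < (⨅ i, a i) - qPlus α c ∨ (⨆ i, a i) + qPlus α c < y) :
    ⌈(1 - α) * (n + 1)⌉₊ ≤ {i : Fin n | c i < ⨅ j, |y - a j|}.ncard := by
  have : Nonempty (Fin n) := ⟨⟨0, hn⟩⟩
  have hk : ⌈(1 - α) * (n + 1)⌉₊ ≤ n := Nat.ceil_le.2 (by linarith)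
  exact le_ncard_of_orderStat_lt c hk (lt_iInf_abs_sub_of_outside a hy)
end
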